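/- Failure of quantifier elimination for ACF with relevant equality: suppose the equality symbol = is treated as a non-logical binary predicate with a possibly world-relative interpretation in B-models (subject only to the heredity condition Rsαβ implies V(α,=) ⊆ V(β,=)), and let ACF= be ACF together with the axioms (R) ∀x(x=x), (T) ∀x,y,z((x=y ∧ y=z)→x=z), and (L) ∀x,y((x=y ∧ A(x))→A(y)) for every formula A. Let C be any class of such B-models over the signature of ACF that contains every RM-model. Then the formula ∃x(¬(x=y) ∧ ¬(x=x)), with free variable y, is not equivalent over C (relative to ACF=) to any quantifier-free formula of the language of ACF; hence ACF= does not admit quantifier elimination over C. -/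

import Mathlib

namespace RM

/-- A first-order signature: function symbols with arities and
relation symbols with arities. -/
structure Signature where
  Func : Type
  farity : Func → ℕ
  Rel : Type
  rarity : Rel → ℕ

variable {σ : Signature}

/-- Terms over a signature, with variables indexed by `ℕ`. -/
inductive Term (σ : Signature) : Type where
  | var : ℕ → Term σ
  | func : (f : σ.Func) → (Fin (σ.farity f) → Term σ) → Term σ

/-- Formulas of the quantificational relevant language:
`⊥`, `⊤`, (logical) equality, atomic relations, `∧`, `∨`, `¬`, `→`, `∀`, `∃`. -/
inductive Formula (σ : Signature) : Type where
  | falsum : Formula σ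
  | verum : Formula σ
  | equal : Term σ → Term σ → Formula σ
  | rel : (r : σ.Rel) → (Fin (σ.rarity r) → Term σ) → Formula σ
  | and : Formula σ → Formula σ → Formula σ
  | or : Formula σ → Formula σ → Formula σ
  | neg : Formula σ → Formula σ
  | imp : Formula σ → Formula σ → Formula σ
  | all : ℕ → Formula σ → Formula σ
  | ex : ℕ → Formula σ → Formula σ

/-- The relevant biconditional `A ↔ B := (A → B) ∧ (B → A)`. -/
def Formula.iff (A B : Formula σ) : Formula σ := .and (.imp A B) (.imp B A)

/-- Free variables of a term. -/
def Term.fv : Term σ → Set ℕ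
  | .var n => {n}
  | .func _ ts => ⋃ i, (ts i).fv

/-- Free variables of a formula. -/
def Formula.fv : Formula σ → Set ℕ
  | .falsum => ∅
  | .verum => ∅
  | .equal t u => t.fv ∪ u.fv
  | .rel _ ts => ⋃ i, (ts i).fv
  | .and A B => A.fv ∪ B.fv
  | .or A B => A.fv ∪ B.fv
  | .imp A B => A.fv ∪ B.fv
  | .neg A => A.fv
  | .all x A => A.fv \ {x}
  | .ex x A => A.fv \ {x}

/-- Quantifier-free formulas. -/
def Formula.QFree : Formula σ → Prop
  | .falsum => True
  | .verum => True
  | .equal _ _ => True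
  | .rel _ _ => True
  | .and A B => A.QFree ∧ B.QFree
  | .or A B => A.QFree ∧ B.QFree
  | .imp A B => A.QFree ∧ B.QFree
  | .neg A => A.QFree
  | .all _ _ => False
  | .ex _ _ => False

/-- A sentence is a formula with no free variables. -/
def Formula.Sentence (A : Formula σ) : Prop := A.fv = ∅

/-- A `B`-model (Routley–Meyer model for the basic relevant logic **B**):
worlds `W`, ternary relation `R`, domain `D`, Routley star `*`,
designated world `s`, world-independent interpretation of function symbols,
world-relative valuation `V` of relation symbols, subject to the usual
conditions; the logical equality symbol is always interpreted as real identity. -/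
structure BModel (σ : Signature) where
  W : Type
  R : W → W → W → Prop
  D : Type
  dne : Nonempty D
  star : W → W
  s : W
  interpFunc : (f : σ.Func) → (Fin (σ.farity f) → D) → D
  V : W → (r : σ.Rel) → (Fin (σ.rarity r) → D) → Prop
  base : ∀ α, R s α α
  btrans : ∀ α β γ δ, R s α β → R β γ δ → R α γ δ
  star_star : ∀ α, star (star α) = α
  star_anti : ∀ α β, R s α β → R s (star β) (star α)
  hered : ∀ α β, R s α β → ∀ r v, V α r v → V β r v

namespace BModel

variable (M : BModel σ)

/-- Evaluation of a term under an assignment. -/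
def evalT (a : ℕ → M.D) : Term σ → M.D
  | .var n => a n
  | .func f ts => M.interpFunc f fun i => evalT a (ts i)

/-- Truth of a formula at a world, under an assignment of domain
elements to variables (Routley–Meyer truth conditions). -/
def Truth : M.W → (ℕ → M.D) → Formula σ → Prop
  | _, _, .falsum => False
  | _, _, .verum => True
  | _, a, .equal t u => M.evalT a t = M.evalT a u
  | w, a, .rel r ts => M.V w r fun i => M.evalT a (ts i)
  | w, a, .and A B => Truth w a A ∧ Truth w a B
  | w, a, .or A B => Truth w a A ∨ Truth w a B
  | w, a, .neg A => ¬ Truth (M.star w) a A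
  | w, a, .imp A B => ∀ w₁ w₂, M.R w w₁ w₂ → Truth w₁ a A → Truth w₂ a B
  | w, a, .all x A => ∀ d : M.D, Truth w (Function.update a x d) A
  | w, a, .ex x A => ∃ d : M.D, Truth w (Function.update a x d) A

/-- `M` satisfies `A` (at the designated world, under every assignment). -/
def SatAx (A : Formula σ) : Prop := ∀ a : ℕ → M.D, M.Truth M.s a A

/-- `M` satisfies the theory `T` at its designated world. -/
def SatTheory (T : Set (Formula σ)) : Prop := ∀ A ∈ T, M.SatAx A

/-- Seriality: every world sees some pair via `R`. -/
def Serial : Prop := ∀ x : M.W, ∃ y z, M.R x y z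

/-- The frame condition corresponding to the axiom `K`: `Rαβγ → Rsαγ`. -/
def Kcond : Prop := ∀ α β γ, M.R α β γ → M.R M.s α γ

/-- The additional frame conditions making a `B`-model an `RM`-model. -/
def IsRM : Prop :=
  (∀ α β γ, M.R α β γ → M.R α (M.star γ) (M.star β)) ∧
  (∀ α β γ, M.R α β γ → M.R α γ β) ∧
  (∀ α, M.R α α α) ∧
  (∀ α β γ δ, (∃ x, M.R α β x ∧ M.R x γ δ) → ∃ y, M.R α y δ ∧ M.R β γ y) ∧
  (∀ α β γ, M.R α β γ → M.R M.s α γ ∨ M.R M.s β γ)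

end BModel

/-- Semantic entailment over a class `C` of `B`-models: every model in `C`
whose designated world satisfies all of `T` also satisfies `A` at its
designated world. -/
def Entails (C : BModel σ → Prop) (T : Set (Formula σ)) (A : Formula σ) : Prop :=
  ∀ M : BModel σ, C M → M.SatTheory T → M.SatAx A

end RM


open RM

namespace RM

variable {σ : Signature}

/-- Replace the variable `u` by the variable `w` in a term. -/
def Term.substV (u w : ℕ) : Term σ → Term σ
  | .var n => if n = u then .var w else .var n
  | .func f ts => .func f fun i => (ts i).substV u w

/-- All variables (free or bound) occurring in a formula. -/
def Formula.vars : Formula σ → Set ℕ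
  | .falsum => ∅
  | .verum => ∅
  | .equal t u => t.fv ∪ u.fv
  | .rel _ ts => ⋃ i, (ts i).fv
  | .and A B => A.vars ∪ B.vars
  | .or A B => A.vars ∪ B.vars
  | .imp A B => A.vars ∪ B.vars
  | .neg A => A.vars
  | .all x A => insert x A.vars
  | .ex x A => insert x A.vars

/-- Substitute the variable `w` for all free occurrences of the variable `u`. -/
def Formula.substFree (u w : ℕ) : Formula σ → Formula σ
  | .falsum => .falsum
  | .verum => .verum
  | .equal t t' => .equal (t.substV u w) (t'.substV u w)
  | .rel r ts => .rel r fun i => (ts i).substV u w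
  | .and A B => .and (A.substFree u w) (B.substFree u w)
  | .or A B => .or (A.substFree u w) (B.substFree u w)
  | .imp A B => .imp (A.substFree u w) (B.substFree u w)
  | .neg A => .neg (A.substFree u w)
  | .all x A => if x = u then .all x A else .all x (A.substFree u w)
  | .ex x A => if x = u then .ex x A else .ex x (A.substFree u w)

/-- Formulas not containing the logical equality constructor (the formulas of
a language in which `=` is a non-logical predicate symbol). -/
def Formula.EqFree : Formula σ → Prop
  | .falsum => True
  | .verum => True
  | .equal _ _ => False
  | .rel _ _ => True
  | .and A B => A.EqFree ∧ B.EqFree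
  | .or A B => A.EqFree ∧ B.EqFree
  | .imp A B => A.EqFree ∧ B.EqFree
  | .neg A => A.EqFree
  | .all _ A => A.EqFree
  | .ex _ A => A.EqFree

end RM

/-- Function symbols of the signature of ACF. -/
inductive ACFFunc : Type where
  | plus | times | neg | inv | zero | one

/-- The signature of ACF with `=` as a non-logical binary predicate symbol. -/
def acfEqSig : Signature :=
  ⟨ACFFunc,
   fun f => match f with
     | .plus => 2 | .times => 2 | .neg => 1 | .inv => 1 | .zero => 0 | .one => 0,
   Unit, fun _ => 2⟩

namespace ACFEq

def v (n : ℕ) : Term acfEqSig := .var n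
def add (t u : Term acfEqSig) : Term acfEqSig := .func .plus ![t, u]
def mul (t u : Term acfEqSig) : Term acfEqSig := .func .times ![t, u]
def minus (t : Term acfEqSig) : Term acfEqSig := .func .neg ![t]
def inv (t : Term acfEqSig) : Term acfEqSig := .func .inv ![t]
def c0 : Term acfEqSig := .func .zero ![]
def c1 : Term acfEqSig := .func .one ![]

/-- The non-logical equality atom `t = u`. -/
def eq (t u : Term acfEqSig) : Formula acfEqSig := .rel () ![t, u]

/-- `t ^ n` as a term (`t ^ 0 = 1`). -/
def pow (t : Term acfEqSig) : ℕ → Term acfEqSig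
  | 0 => c1
  | n + 1 => mul t (pow t n)

/-- The sum of a list of terms. -/
def tsum : List (Term acfEqSig) → Term acfEqSig
  | [] => c0
  | [t] => t
  | t :: u :: ts => add t (tsum (u :: ts))

/-- The term `yⁿ + x₁·yⁿ⁻¹ + ⋯ + xₙ`, where `y` is the variable `0` and
`xᵢ` is the variable `i`. -/
def poly (n : ℕ) : Term acfEqSig :=
  tsum (pow (v 0) n :: (List.range n).map fun i => mul (v (i + 1)) (pow (v 0) (n - 1 - i)))

/-- Universal closure over a list of variables. -/
def alls (l : List ℕ) (A : Formula acfEqSig) : Formula acfEqSig := l.foldr Formula.all A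

def ax1 : Formula acfEqSig :=
  .all 0 (.all 1 (.all 2 (eq (add (add (v 0) (v 1)) (v 2)) (add (v 0) (add (v 1) (v 2))))))
def ax2 : Formula acfEqSig := .all 0 (eq (add (v 0) c0) (v 0))
def ax3 : Formula acfEqSig := .all 0 (eq (add (v 0) (minus (v 0))) c0)
def ax4 : Formula acfEqSig := .all 0 (.all 1 (eq (add (v 0) (v 1)) (add (v 1) (v 0))))
def ax5 : Formula acfEqSig :=
  .all 0 (.all 1 (.all 2 (eq (mul (mul (v 0) (v 1)) (v 2)) (mul (v 0) (mul (v 1) (v 2))))))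
def ax6 : Formula acfEqSig := .all 0 (eq (mul (v 0) c1) (v 0))
def ax7 : Formula acfEqSig :=
  .all 0 (.imp (.neg (eq (v 0) c0)) (eq (mul (v 0) (inv (v 0))) c1))
def ax8 : Formula acfEqSig := .all 0 (.all 1 (eq (mul (v 0) (v 1)) (mul (v 1) (v 0))))
def ax9 : Formula acfEqSig :=
  .all 0 (.all 1 (.all 2 (eq (mul (v 0) (add (v 1) (v 2))) (add (mul (v 0) (v 1)) (mul (v 0) (v 2))))))
def ax10 : Formula acfEqSig := .imp (eq c0 c1) .falsum
/-- A11ₙ: `∀x₁,…,xₙ ∃y (yⁿ + x₁yⁿ⁻¹ + ⋯ + xₙ = 0)`, for each `n > 0`. -/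
def ax11 (n : ℕ) : Formula acfEqSig :=
  alls ((List.range n).map (· + 1)) (.ex 0 (eq (poly n) c0))

/-- (R): `∀x(x = x)`. -/
def axR : Formula acfEqSig := .all 0 (eq (v 0) (v 0))
/-- (T): `∀x,y,z((x=y ∧ y=z) → x=z)`. -/
def axT : Formula acfEqSig :=
  .all 0 (.all 1 (.all 2 (.imp (.and (eq (v 0) (v 1)) (eq (v 1) (v 2))) (eq (v 0) (v 2)))))
/-- (L): `∀x,y((x=y ∧ A(x)) → A(y))`, with `x` the variable `0`, `y` the
variable `1` (required not to occur in `A`, so that `A(y)` is obtained by a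
capture-free substitution). -/
def axL (A : Formula acfEqSig) : Formula acfEqSig :=
  .all 0 (.all 1 (.imp (.and (eq (v 0) (v 1)) A) (A.substFree 0 1)))

/-- The theory ACF⁼: the ACF axioms (stated with the non-logical `=`),
together with reflexivity, transitivity, and the Leibniz-law scheme. -/
def theory : Set (Formula acfEqSig) :=
  {ax1, ax2, ax3, ax4, ax5, ax6, ax7, ax8, ax9, ax10, axR, axT} ∪
  {A | ∃ n : ℕ, 0 < n ∧ A = ax11 n} ∪
  {F | ∃ A : Formula acfEqSig, A.EqFree ∧ 1 ∉ A.vars ∧ F = axL A}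

end ACFEq

/-- The formula `∃x(¬(x=y) ∧ ¬(x=x))`, with `y` the variable `1` and `x` the
variable `0` (with `=` the non-logical equality predicate). -/
def phi : Formula acfEqSig :=
  .ex 0 (.and (.neg (ACFEq.eq (ACFEq.v 0) (ACFEq.v 1)))
    (.neg (ACFEq.eq (ACFEq.v 0) (ACFEq.v 0))))


namespace RM

variable {σ : Signature}

/-- Renaming a variable to one with the same value does not change the value of a term. -/
theorem BModel.evalT_substV (M : BModel σ) {u w : ℕ} {a : ℕ → M.D} (h : a u = a w)
    (t : Term σ) : M.evalT a (t.substV u w) = M.evalT a t := by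
  induction t with
  | var n =>
    by_cases hn : n = u
    · simp [Term.substV, hn, BModel.evalT, h]
    · simp [Term.substV, hn]
  | func f ts ih => simp only [Term.substV, BModel.evalT, ih]

/-- Renaming a variable to a fresh one with the same value does not change the truth of a
formula. -/
theorem BModel.truth_substFree (M : BModel σ) {u w : ℕ} (A : Formula σ) (hw : w ∉ A.vars)
    (x : M.W) (a : ℕ → M.D) (h : a u = a w) :
    M.Truth x a (A.substFree u w) ↔ M.Truth x a A := by
  have update_eq {y : ℕ} (hy : y ≠ u) (hyw : w ≠ y) (a : ℕ → M.D) (h : a u = a w) (d : M.D) :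
      Function.update a y d u = Function.update a y d w := by
    rw [Function.update_of_ne hy.symm, Function.update_of_ne hyw, h]
  induction A generalizing x a with
  | falsum => rfl
  | verum => rfl
  | equal t t' => simp only [Formula.substFree, BModel.Truth, M.evalT_substV h]
  | rel r ts => simp only [Formula.substFree, BModel.Truth, M.evalT_substV h]
  | and A B ihA ihB =>
    simp only [Formula.vars, Set.mem_union, not_or] at hw
    simp only [Formula.substFree, BModel.Truth, ihA hw.1 x a h, ihB hw.2 x a h]
  | or A B ihA ihB =>
    simp only [Formula.vars, Set.mem_union, not_or] at hw
    simp only [Formula.substFree, BModel.Truth, ihA hw.1 x a h, ihB hw.2 x a h]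
  | neg A ih => simp only [Formula.substFree, BModel.Truth, ih hw _ a h]
  | imp A B ihA ihB =>
    simp only [Formula.vars, Set.mem_union, not_or] at hw
    simp only [Formula.substFree, BModel.Truth, ihA hw.1 _ a h, ihB hw.2 _ a h]
  | all y A ih =>
    simp only [Formula.vars, Set.mem_insert_iff, not_or] at hw
    by_cases hy : y = u
    · simp [Formula.substFree, hy]
    · simp only [Formula.substFree, hy, if_false, BModel.Truth]
      exact forall_congr' fun d => ih hw.2 x _ (update_eq hy hw.1 a h d)
  | ex y A ih =>
    simp only [Formula.vars, Set.mem_insert_iff, not_or] at hw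
    by_cases hy : y = u
    · simp [Formula.substFree, hy]
    · simp only [Formula.substFree, hy, if_false, BModel.Truth]
      exact exists_congr fun d => ih hw.2 x _ (update_eq hy hw.1 a h d)

end RM

namespace ACFEq

/-- The field operations of `ℂ` as an interpretation of the function symbols of ACF. -/
noncomputable def complexInterp : (f : acfEqSig.Func) → (Fin (acfEqSig.farity f) → ℂ) → ℂ
  | .plus => fun (x : Fin 2 → ℂ) => x 0 + x 1
  | .times => fun (x : Fin 2 → ℂ) => x 0 * x 1
  | .neg => fun (x : Fin 1 → ℂ) => -x 0
  | .inv => fun (x : Fin 1 → ℂ) => (x 0)⁻¹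
  | .zero => fun _ => 0
  | .one => fun _ => 1

/-- The two-world model over `ℂ` in which `=` is the identity at the designated world `true`,
and the identity restricted to the reals at the world `false`. -/
noncomputable def realModel : BModel acfEqSig where
  W := Bool
  R := fun _ β γ => β = γ
  D := ℂ
  dne := ⟨0⟩
  star := id
  s := true
  interpFunc := complexInterp
  V := fun w _ (x : Fin 2 → ℂ) => x 0 = x 1 ∧ (w = false → (x 0).im = 0)
  base _ := rfl
  btrans _ _ _ _ _ h := h
  star_star _ := rfl
  star_anti _ _ h := h.symm
  hered _ _ h _ _ hV := h ▸ hV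

theorem realModel_isRM : realModel.IsRM :=
  ⟨fun _ _ _ h => Eq.symm h, fun _ _ _ h => Eq.symm h, fun _ => rfl,
    fun _ _ _ δ ⟨_, _, h⟩ => ⟨δ, rfl, h⟩, fun _ _ _ h => Or.inr h⟩

/-- Truth in `realModel`, under an assignment of complex numbers. -/
def Holds (w : Bool) (a : ℕ → ℂ) (A : Formula acfEqSig) : Prop := realModel.Truth w a A

section Evaluation

variable (a : ℕ → ℂ) (t u : Term acfEqSig)

/-- The value of a term in `realModel`, as a complex number. -/
noncomputable def val : ℂ := realModel.evalT a t

theorem val_v (n : ℕ) : val a (v n) = a n := rfl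

theorem val_add : val a (add t u) = val a t + val a u := rfl

theorem val_mul : val a (mul t u) = val a t * val a u := rfl

theorem val_minus : val a (minus t) = -val a t := rfl

theorem val_inv : val a (inv t) = (val a t)⁻¹ := rfl

theorem val_c0 : val a c0 = 0 := rfl

theorem val_c1 : val a c1 = 1 := rfl

theorem val_pow (n : ℕ) : val a (pow t n) = val a t ^ n := by
  induction n with
  | zero => simp [pow, val_c1]
  | succ n ih => rw [pow, val_mul, ih, pow_succ']

theorem val_tsum (l : List (Term acfEqSig)) : val a (tsum l) = (l.map (val a)).sum := by
  induction l with
  | nil => simp [tsum, val_c0]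
  | cons t l ih =>
    cases l with
    | nil => simp [tsum]
    | cons u l => rw [tsum, val_add, ih, List.map_cons (a := t), List.sum_cons]

theorem val_poly (n : ℕ) :
    val a (poly n) = a 0 ^ n + ∑ i ∈ Finset.range n, a (i + 1) * a 0 ^ (n - 1 - i) := by
  rw [poly, val_tsum, List.map_cons, List.sum_cons, val_pow, val_v, List.map_map,
    ← List.sum_toFinset _ List.nodup_range, List.toFinset_range]
  refine congrArg _ (Finset.sum_congr rfl fun i _ => ?_)
  rw [Function.comp_apply, val_mul, val_v, val_pow, val_v]

theorem truth_eq (w : Bool) : Holds w a (eq t u) ↔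
    val a t = val a u ∧ (w = false → (val a t).im = 0) := Iff.rfl

theorem truth_imp (w : Bool) (A B : Formula acfEqSig) : Holds w a (.imp A B) ↔
    ∀ w' : Bool, Holds w' a A → Holds w' a B :=
  ⟨fun h w' => h w' w' rfl, fun h w₁ w₂ h₁₂ => (show w₁ = w₂ from h₁₂) ▸ h w₁⟩

theorem truth_neg (w : Bool) (A : Formula acfEqSig) :
    Holds w a (.neg A) ↔ ¬ Holds w a A := Iff.rfl

theorem truth_and (w : Bool) (A B : Formula acfEqSig) : Holds w a (.and A B) ↔
    Holds w a A ∧ Holds w a B := Iff.rfl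

theorem truth_all (w : Bool) (n : ℕ) (A : Formula acfEqSig) : Holds w a (.all n A) ↔
    ∀ z : ℂ, Holds w (Function.update a n z) A := Iff.rfl

theorem truth_ex (w : Bool) (n : ℕ) (A : Formula acfEqSig) : Holds w a (.ex n A) ↔
    ∃ z : ℂ, Holds w (Function.update a n z) A := Iff.rfl

theorem truth_falsum (w : Bool) : ¬ Holds w a .falsum := id

theorem truth_alls (w : Bool) (l : List ℕ) (A : Formula acfEqSig)
    (h : ∀ a : ℕ → ℂ, Holds w a A) : Holds w a (alls l A) := by
  induction l generalizing a with
  | nil => exact h a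
  | cons n l ih => exact fun z => ih _

end Evaluation

theorem exists_root_of_coeffs {K : Type*} [Field K] [IsAlgClosed K] (c : ℕ → K) {n : ℕ}
    (hn : 0 < n) : ∃ z : K, z ^ n + ∑ i ∈ Finset.range n, c (i + 1) * z ^ (n - 1 - i) = 0 := by
  let q : Polynomial K :=
    ∑ i ∈ Finset.range n, Polynomial.C (c (i + 1)) * Polynomial.X ^ (n - 1 - i)
  have hq : q.degree < n := by
    refine (Polynomial.degree_sum_le _ _).trans_lt ?_
    refine (Finset.sup_lt_iff (WithBot.bot_lt_coe n)).2 fun i _ => ?_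
    refine (Polynomial.degree_C_mul_X_pow_le _ _).trans_lt ?_
    exact WithBot.coe_lt_coe.2 (show n - 1 - i < n by omega)
  have hdeg : (Polynomial.X ^ n + q).degree = (n : WithBot ℕ) := by
    rw [Polynomial.degree_add_eq_left_of_degree_lt (by rwa [Polynomial.degree_X_pow]),
      Polynomial.degree_X_pow]
  obtain ⟨z, hz⟩ := IsAlgClosed.exists_root (Polynomial.X ^ n + q) (by
    rw [hdeg]
    exact_mod_cast hn.ne')
  refine ⟨z, ?_⟩
  simpa [q, Polynomial.IsRoot, Polynomial.eval_finsetSum] using hz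

theorem realModel_satTheory : realModel.SatTheory theory := by
  rintro F ((hF | ⟨n, hn, rfl⟩) | ⟨A, -, hA, rfl⟩) (a : ℕ → ℂ) <;>
    change Holds true a _
  · simp only [Set.mem_insert_iff, Set.mem_singleton_iff] at hF
    rcases hF with rfl | rfl | rfl | rfl | rfl | rfl | rfl | rfl | rfl | rfl | rfl | rfl
    all_goals
      simp [ax1, ax2, ax3, ax4, ax5, ax6, ax7, ax8, ax9, ax10, axR, axT, truth_eq, truth_imp,
        truth_neg, truth_and, truth_all, truth_falsum, val_v, val_add, val_mul, val_minus,
        val_inv, val_c0, val_c1]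
    · exact add_assoc
    · exact add_comm
    · exact mul_assoc
    · intro z
      refine ⟨fun h => ?_, mul_inv_cancel₀⟩
      have hz : z ≠ 0 := fun hz => h hz (by simp [hz])
      exact ⟨mul_inv_cancel₀ hz, by ring⟩
    · exact mul_comm
    · exact mul_add
    · rintro x y z
      exact ⟨fun hxy hx hyz _ => ⟨hxy.trans hyz, hx⟩, Eq.trans⟩
  · refine truth_alls a true _ _ fun a => ?_
    obtain ⟨z, hz⟩ := exists_root_of_coeffs a hn
    refine (truth_ex ..).2 ⟨z, (truth_eq ..).2 ⟨?_, by simp⟩⟩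
    simpa [val_poly, val_c0] using hz
  · intro x y
    refine (truth_imp ..).2 fun w h => ?_
    obtain ⟨⟨hxy, -⟩, hx⟩ := h
    exact (realModel.truth_substFree A hA w _ hxy).2 hx

/-- Terms whose variables take real values have real values. -/
theorem val_im_eq_zero {a : ℕ → ℂ} (t : Term acfEqSig) (h : ∀ n ∈ t.fv, (a n).im = 0) :
    (val a t).im = 0 := by
  induction t with
  | var n => exact h n rfl
  | func f ts ih =>
    have hts (i) : (val a (ts i)).im = 0 :=
      ih i fun n hn => h n (Set.mem_iUnion.2 ⟨i, hn⟩)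
    cases f with
    | plus =>
      have key (x y : ℂ) (hx : x.im = 0) (hy : y.im = 0) : (x + y).im = 0 := by simp [hx, hy]
      exact key _ _ (hts (0 : Fin 2)) (hts (1 : Fin 2))
    | times =>
      have key (x y : ℂ) (hx : x.im = 0) (hy : y.im = 0) : (x * y).im = 0 := by simp [hx, hy]
      exact key _ _ (hts (0 : Fin 2)) (hts (1 : Fin 2))
    | neg =>
      have key (x : ℂ) (hx : x.im = 0) : (-x).im = 0 := by simp [hx]
      exact key _ (hts (0 : Fin 1))
    | inv =>
      have key (x : ℂ) (hx : x.im = 0) : (x⁻¹).im = 0 := by simp [hx]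
      exact key _ (hts (0 : Fin 1))
    | zero => exact Complex.zero_im
    | one => exact Complex.one_im

/-- Under real assignments, the worlds of `realModel` agree on quantifier-free formulas. -/
theorem truth_iff_of_qfree {a : ℕ → ℂ} {B : Formula acfEqSig} (hB : B.QFree)
    (h : ∀ n ∈ B.fv, (a n).im = 0) (w w' : Bool) :
    Holds w a B ↔ Holds w' a B := by
  induction B with
  | falsum => rfl
  | verum => rfl
  | equal t u => rfl
  | rel r ts =>
    have hts (w : Bool) : Holds w a (.rel r ts) ↔
        val a (ts (0 : Fin 2)) = val a (ts (1 : Fin 2)) :=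
      and_iff_left fun _ =>
        val_im_eq_zero _ fun n hn => h n (Set.mem_iUnion.2 ⟨(0 : Fin 2), hn⟩)
    rw [hts, hts]
  | and A B ihA ihB =>
    exact and_congr (ihA hB.1 fun n hn => h n (.inl hn)) (ihB hB.2 fun n hn => h n (.inr hn))
  | or A B ihA ihB =>
    exact or_congr (ihA hB.1 fun n hn => h n (.inl hn)) (ihB hB.2 fun n hn => h n (.inr hn))
  | neg A ih => exact not_congr (ih hB h)
  | imp A B => rw [truth_imp, truth_imp]
  | all n A => exact hB.elim
  | ex n A => exact hB.elim

/-- In `realModel`, `phi` holds exactly at the non-designated world. -/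
theorem truth_phi_iff (a : ℕ → ℂ) (w : Bool) : Holds w a phi ↔ w = false := by
  rw [phi, truth_ex]
  constructor
  · rintro ⟨z, -, hz⟩
    by_contra hw
    exact hz ⟨rfl, fun h => absurd h hw⟩
  · rintro rfl
    have hI : Complex.I.im ≠ 0 := by simp
    exact ⟨Complex.I, fun h => hI (h.2 rfl), fun h => hI (h.2 rfl)⟩

end ACFEq

/-- **Failure of quantifier elimination for ACF with relevant equality**:
with `=` a non-logical world-relative predicate and ACF⁼ the theory of ACF
plus reflexivity, transitivity and the Leibniz scheme for `=`, over any class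
`C` of `B`-models containing all `RM`-models, the formula `∃x(¬(x=y) ∧ ¬(x=x))`
is not ACF⁼-equivalent over `C` to any quantifier-free formula of the language
in the variable `y`. -/
theorem stmt_19 (C : BModel acfEqSig → Prop) (hC : ∀ M : BModel acfEqSig, M.IsRM → C M) :
    ¬ ∃ B : Formula acfEqSig, B.QFree ∧ B.EqFree ∧ B.fv ⊆ {1} ∧
      Entails C ACFEq.theory (phi.iff B) := by
  rintro ⟨B, hB, -, hfv, h⟩
  have hiff := h _ (hC _ ACFEq.realModel_isRM) ACFEq.realModel_satTheory (fun _ => (0 : ℂ))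
  have htrue := hiff.2 true true rfl
  have hfalse := hiff.1 false false rfl ((ACFEq.truth_phi_iff _ false).2 rfl)
  have hB' := (ACFEq.truth_iff_of_qfree hB (fun _ _ => Complex.zero_im) false true).1 hfalse
  exact Bool.noConfusion ((ACFEq.truth_phi_iff _ true).1 (htrue hB'))
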